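/- If G is a link-irregular graph with n > 277 vertices, then G is not planar. -/

import Mathlib

open SimpleGraph Finset

/-- The link of a vertex `v`: the subgraph induced by the neighborhood of `v`. -/
def SimpleGraph.link {V : Type*} (G : SimpleGraph V) (v : V) :
    SimpleGraph (G.neighborSet v) :=
  G.induce (G.neighborSet v)

/-- A graph is link-irregular if the links of any two distinct vertices are
non-isomorphic. -/
def SimpleGraph.LinkIrregular {V : Type*} (G : SimpleGraph V) : Prop :=
  ∀ u v : V, u ≠ v → ¬ Nonempty (G.link u ≃g G.link v)

/-- `H` is a minor of `G`: there are disjoint nonempty connected branch sets in `G`,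
one for each vertex of `H`, with an edge of `G` between the branch sets of any two
adjacent vertices of `H`. -/
def SimpleGraph.HasMinor {V W : Type*} (G : SimpleGraph V) (H : SimpleGraph W) : Prop :=
  ∃ f : W → Set V,
    (∀ w, (f w).Nonempty) ∧
    (∀ w, (G.induce (f w)).Connected) ∧
    (Pairwise fun w₁ w₂ => Disjoint (f w₁) (f w₂)) ∧
    (∀ w₁ w₂, H.Adj w₁ w₂ → ∃ a ∈ f w₁, ∃ b ∈ f w₂, G.Adj a b)

/-- Planarity, via Wagner's characterization: a graph is planar iff it has neither
a `K₅` minor nor a `K₃,₃` minor. -/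
def SimpleGraph.Planar {V : Type*} (G : SimpleGraph V) : Prop :=
  ¬ G.HasMinor (completeGraph (Fin 5)) ∧
  ¬ G.HasMinor (completeBipartiteGraph (Fin 3) (Fin 3))


namespace SimpleGraph

section Minor

variable {V W : Type*}

/-- `f` assigns disjoint connected branch sets in `G` to the vertices in `S`, realizing as a minor
the graph `H`, all of whose edges lie in `S`. -/
structure IsModelOn (G : SimpleGraph V) (H : SimpleGraph W) (S : Finset W) (f : W → Set V) :
    Prop where
  mem_of_adj : ∀ ⦃x y⦄, H.Adj x y → x ∈ S
  connected : ∀ x ∈ S, (G.induce (f x)).Connected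
  disjoint : ∀ x ∈ S, ∀ y ∈ S, x ≠ y → Disjoint (f x) (f y)
  exists_adj : ∀ ⦃x y⦄, H.Adj x y → ∃ a ∈ f x, ∃ b ∈ f y, G.Adj a b

lemma isModelOn_self [Fintype V] (G : SimpleGraph V) :
    G.IsModelOn G Finset.univ (fun v => {v}) where
  mem_of_adj _ _ _ := Finset.mem_univ _
  connected x _ := by
    have : Subsingleton ({x} : Set V) := Set.subsingleton_coe _ |>.2 Set.subsingleton_singleton
    have : Nonempty ({x} : Set V) := ⟨⟨x, rfl⟩⟩
    exact { preconnected := Preconnected.of_subsingleton }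
  disjoint x _ y _ h := by simpa using h
  exists_adj x y h := ⟨x, rfl, y, rfl, h⟩

lemma IsModelOn.mono {G : SimpleGraph V} {H H' : SimpleGraph W} {S : Finset W} {f : W → Set V}
    (h : G.IsModelOn H S f) (hle : H' ≤ H) : G.IsModelOn H' S f where
  mem_of_adj _ _ hxy := h.mem_of_adj (hle hxy)
  connected := h.connected
  disjoint := h.disjoint
  exists_adj _ _ hxy := h.exists_adj (hle hxy)

lemma IsModelOn.hasMinor_of_not_cliqueFree {G : SimpleGraph V} {H : SimpleGraph W} {S : Finset W}
    {f : W → Set V} (h : G.IsModelOn H S f) {n : ℕ} (hn : 2 ≤ n) (hH : ¬ H.CliqueFree n) :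
    G.HasMinor (completeGraph (Fin n)) := by
  have φ := topEmbeddingOfNotCliqueFree hH
  have hadj : ∀ i j, i ≠ j → H.Adj (φ i) (φ j) := fun i j hij => φ.map_adj_iff.2 hij
  have : Nontrivial (Fin n) := Fin.nontrivial_iff_two_le.2 hn
  have hmem : ∀ i, φ i ∈ S := fun i => by
    obtain ⟨j, hj⟩ := exists_ne i
    exact h.mem_of_adj (hadj i j hj.symm)
  refine ⟨fun i => f (φ i), fun i => ?_, fun i => h.connected _ (hmem i), fun i j hij => ?_,
    fun i j hij => h.exists_adj (hadj i j hij)⟩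
  · exact Set.nonempty_coe_sort.1 (h.connected _ (hmem i)).nonempty
  · exact h.disjoint _ (hmem i) _ (hmem j) (hadj i j hij).ne

/-- The graph obtained by contracting `b` into `a`, with `b` kept as an isolated vertex. -/
def contractInto (H : SimpleGraph W) (a b : W) : SimpleGraph W where
  Adj x y := x ≠ y ∧ x ≠ b ∧ y ≠ b ∧ (H.Adj x y ∨ (x = a ∧ H.Adj b y) ∨ (y = a ∧ H.Adj b x))
  symm := ⟨fun _ _ h => ⟨h.1.symm, h.2.2.1, h.2.1, h.2.2.2.imp (fun h' => h'.symm) Or.symm⟩⟩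
  loopless := ⟨fun _ h => h.1 rfl⟩

lemma IsModelOn.contractInto [DecidableEq W] {G : SimpleGraph V} {H : SimpleGraph W} {S : Finset W}
    {f : W → Set V} (h : G.IsModelOn H S f) {a b : W} (hab : H.Adj a b) :
    G.IsModelOn (H.contractInto a b) (S.erase b) (Function.update f a (f a ∪ f b)) := by
  have ha := h.mem_of_adj hab
  have hb := h.mem_of_adj hab.symm
  have hdisj : ∀ x ∈ S, x ≠ a → x ≠ b → Disjoint (f a ∪ f b) (f x) := fun x hx hxa hxb =>
    Set.disjoint_union_left.2 ⟨h.disjoint a ha x hx hxa.symm, h.disjoint b hb x hx hxb.symm⟩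
  have hsub : ∀ x, f x ⊆ Function.update f a (f a ∪ f b) x := fun x => by
    obtain rfl | hx := eq_or_ne x a
    · simp
    · simp [Function.update_of_ne hx]
  have hadj : ∀ y, H.Adj b y → y ≠ a → ∃ u ∈ Function.update f a (f a ∪ f b) a,
      ∃ v ∈ Function.update f a (f a ∪ f b) y, G.Adj u v := fun y hy hya => by
    obtain ⟨u, hu, v, hv, huv⟩ := h.exists_adj hy
    exact ⟨u, by simp [hu], v, hsub y hv, huv⟩
  refine ⟨?_, ?_, ?_, ?_⟩
  · rintro x y ⟨-, hxb, -, hxy | ⟨rfl, -⟩ | ⟨-, hxy⟩⟩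
    · exact Finset.mem_erase.2 ⟨hxb, h.mem_of_adj hxy⟩
    · exact Finset.mem_erase.2 ⟨hxb, ha⟩
    · exact Finset.mem_erase.2 ⟨hxb, h.mem_of_adj hxy.symm⟩
  · intro x hx
    obtain ⟨hxb, hx⟩ := Finset.mem_erase.1 hx
    obtain rfl | hxa := eq_or_ne x a
    · obtain ⟨u, hu, v, hv, huv⟩ := h.exists_adj hab
      rw [Function.update_self]
      exact connected_induce_union (h.connected x ha).preconnected
        (h.connected b hb).preconnected hu hv huv
    · rw [Function.update_of_ne hxa]
      exact h.connected x hx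
  · intro x hx y hy hxy
    obtain ⟨hxb, hx⟩ := Finset.mem_erase.1 hx
    obtain ⟨hyb, hy⟩ := Finset.mem_erase.1 hy
    obtain rfl | hxa := eq_or_ne x a
    · rw [Function.update_self, Function.update_of_ne hxy.symm]
      exact hdisj y hy hxy.symm hyb
    · obtain rfl | hya := eq_or_ne y a
      · rw [Function.update_self, Function.update_of_ne hxy]
        exact (hdisj x hx hxy hxb).symm
      · rw [Function.update_of_ne hxa, Function.update_of_ne hya]
        exact h.disjoint x hx y hy hxy
  · rintro x y ⟨hxy, -, -, h' | ⟨rfl, h'⟩ | ⟨rfl, h'⟩⟩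
    · obtain ⟨u, hu, v, hv, huv⟩ := h.exists_adj h'
      exact ⟨u, hsub x hu, v, hsub y hv, huv⟩
    · exact hadj y h' hxy.symm
    · obtain ⟨u, hu, v, hv, huv⟩ := hadj x h' hxy
      exact ⟨v, hv, u, hu, huv.symm⟩

open scoped Classical in
lemma card_edgeFinset_le_contractInto [Fintype W] {H : SimpleGraph W} {a b : W} (hab : H.Adj a b) :
    #H.edgeFinset ≤ #(H.contractInto a b).edgeFinset + 1 +
      #(H.neighborFinset a ∩ H.neighborFinset b) := by
  set T := H.neighborFinset b \ insert a (H.neighborFinset a)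
  have hT : ∀ y ∈ T, H.Adj b y ∧ y ≠ a ∧ ¬ H.Adj a y := fun y hy => by
    simpa [T] using hy
  have hdeg : H.degree b ≤ #T + 1 + #(H.neighborFinset a ∩ H.neighborFinset b) := by
    have hsub : H.neighborFinset b ⊆ (T ∪ {a}) ∪ (H.neighborFinset a ∩ H.neighborFinset b) := by
      intro y hy
      simp only [T, Finset.mem_union, Finset.mem_sdiff, Finset.mem_insert, Finset.mem_singleton,
        Finset.mem_inter]
      tauto
    calc H.degree b = #(H.neighborFinset b) := (H.card_neighborFinset_eq_degree b).symm
      _ ≤ _ := Finset.card_le_card hsub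
      _ ≤ _ := Finset.card_union_le _ _
      _ ≤ _ := by gcongr; exact Finset.card_union_le _ _
  have hunion : (H.deleteIncidenceSet b).edgeFinset ∪ T.image (fun y => s(a, y)) ⊆
      (H.contractInto a b).edgeFinset := by
    intro e he
    rw [Finset.mem_union] at he
    rw [mem_edgeFinset]
    obtain he | he := he
    · rw [mem_edgeFinset] at he
      induction e with
      | h x y =>
        rw [mem_edgeSet, deleteIncidenceSet_adj] at he
        exact ⟨he.1.ne, he.2.1, he.2.2, Or.inl he.1⟩
    · obtain ⟨y, hy, rfl⟩ := Finset.mem_image.1 he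
      obtain ⟨hby, hya, -⟩ := hT y hy
      exact ⟨hya.symm, hab.ne, hby.ne', Or.inr (Or.inl ⟨rfl, hby⟩)⟩
  have hdisj : Disjoint (H.deleteIncidenceSet b).edgeFinset (T.image (fun y => s(a, y))) := by
    rw [Finset.disjoint_right]
    intro e he he'
    obtain ⟨y, hy, rfl⟩ := Finset.mem_image.1 he
    rw [mem_edgeFinset, mem_edgeSet, deleteIncidenceSet_adj] at he'
    exact (hT y hy).2.2 he'.1
  have hinj : #(T.image (fun y => s(a, y))) = #T :=
    Finset.card_image_of_injective _ fun y z hyz => Sym2.congr_right.1 hyz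
  have hcard := Finset.card_le_card hunion
  rw [Finset.card_union_of_disjoint hdisj, hinj, card_edgeFinset_deleteIncidenceSet] at hcard
  omega

/-- If every neighbor of `v` is adjacent to at least three others and `v` has degree at most five,
then `v` and its neighbors span a `K₅`, possibly after contracting an edge. -/
lemma exists_contractInto_not_cliqueFree [Fintype W] [DecidableEq W] {H : SimpleGraph W}
    [DecidableRel H.Adj] {v : W} (hpos : 0 < H.degree v) (hdeg : H.degree v ≤ 5)
    (hcommon : ∀ x, H.Adj v x → 3 ≤ #(H.neighborFinset v ∩ H.neighborFinset x)) :
    ¬ H.CliqueFree 5 ∨ ∃ a b, H.Adj a b ∧ ¬ (H.contractInto a b).CliqueFree 5 := by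
  rw [← card_neighborFinset_eq_degree] at hpos hdeg
  have hN : ∀ x ∈ H.neighborFinset v, H.Adj v x := fun x hx => (H.mem_neighborFinset v x).1 hx
  have hsub : ∀ x, H.neighborFinset v ∩ H.neighborFinset x ⊆ (H.neighborFinset v).erase x := by
    intro x y hy
    rw [Finset.mem_inter, mem_neighborFinset, mem_neighborFinset] at hy
    exact Finset.mem_erase.2 ⟨hy.2.ne', (H.mem_neighborFinset v y).2 hy.1⟩
  have hfour : 4 ≤ #(H.neighborFinset v) := by
    obtain ⟨x, hx⟩ := Finset.card_pos.1 hpos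
    have h1 := (hcommon x (hN x hx)).trans (Finset.card_le_card (hsub x))
    rw [Finset.card_erase_of_mem hx] at h1
    omega
  by_cases hcl : H.IsClique (H.neighborFinset v : Set W)
  · left
    refine fun hfree => hfree.mono (show 5 ≤ #(H.neighborFinset v) + 1 by omega) _
      (IsNClique.insert ⟨hcl, rfl⟩ hN)
  · right
    rw [isClique_iff, Set.Pairwise] at hcl
    push Not at hcl
    obtain ⟨p, hp, q, hq, hpq, hnadj⟩ := hcl
    rw [Finset.mem_coe] at hp hq
    set R := ((H.neighborFinset v).erase p).erase q
    have hR : #R = #(H.neighborFinset v) - 2 := by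
      rw [Finset.card_erase_of_mem (Finset.mem_erase.2 ⟨hpq.symm, hq⟩),
        Finset.card_erase_of_mem hp]
      omega
    have hRp : H.neighborFinset v ∩ H.neighborFinset p ⊆ R := fun y hy =>
      Finset.mem_erase.2 ⟨by rintro rfl; simp [hnadj] at hy, hsub p hy⟩
    have hRq : H.neighborFinset v ∩ H.neighborFinset q ⊆ R := fun y hy => by
      have := Finset.mem_erase.1 (hsub q hy)
      refine Finset.mem_erase.2 ⟨this.1, Finset.mem_erase.2 ⟨?_, this.2⟩⟩
      rintro rfl
      simp [hnadj, H.adj_comm q] at hy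
    have hRp' := Finset.eq_of_subset_of_card_le hRp (by have := hcommon p (hN p hp); omega)
    have hRq' := Finset.eq_of_subset_of_card_le hRq (by have := hcommon q (hN q hq); omega)
    have hpR : ∀ x ∈ R, H.Adj p x := fun x hx => by
      rw [← hRp', Finset.mem_inter, mem_neighborFinset, mem_neighborFinset] at hx
      exact hx.2
    have hqR : ∀ x ∈ R, H.Adj q x := fun x hx => by
      rw [← hRq', Finset.mem_inter, mem_neighborFinset, mem_neighborFinset] at hx
      exact hx.2
    have hvR : ∀ x ∈ R, H.Adj v x := fun x hx =>
      hN x (Finset.mem_of_mem_erase (Finset.mem_of_mem_erase hx))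
    have key : ∀ x ∈ R, ∀ y ∈ R, ∀ z ∈ R, x ≠ y → x ≠ z → H.Adj y z →
        ∃ a b, H.Adj a b ∧ ¬ (H.contractInto a b).CliqueFree 5 := by
      intro x hx y hy z hz hxy hxz hyz
      refine ⟨p, x, hpR x hx, fun hfree => hfree {v, p, q, y, z} ?_⟩
      have hadj : ∀ s t, s ≠ x → t ≠ x → H.Adj s t → (H.contractInto p x).Adj s t :=
        fun s t hs ht hst => ⟨hst.ne, hs, ht, Or.inl hst⟩
      have hvx := (hvR x hx).ne
      have hpx := (hpR x hx).ne
      have hqx := (hqR x hx).ne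
      have h1 : (H.contractInto p x).IsNClique 1 {z} := by simp [isNClique_iff]
      have h2 := h1.insert (a := y) (by simpa using hadj y z hxy.symm hxz.symm hyz)
      have h3 := h2.insert (a := q) (by
        simpa using ⟨hadj q y hqx hxy.symm (hqR y hy), hadj q z hqx hxz.symm (hqR z hz)⟩)
      have h4 := h3.insert (a := p) (by
        have hpq' : (H.contractInto p x).Adj p q :=
          ⟨hpq, hpx, hqx, Or.inr (Or.inl ⟨rfl, (hqR x hx).symm⟩)⟩
        simpa using ⟨hpq', hadj p y hpx hxy.symm (hpR y hy), hadj p z hpx hxz.symm (hpR z hz)⟩)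
      exact h4.insert (a := v) (by
        simpa using ⟨hadj v p hvx hpx (hN p hp), hadj v q hvx hqx (hN q hq),
          hadj v y hvx hxy.symm (hvR y hy), hadj v z hvx hxz.symm (hvR z hz)⟩)
    have hR3 : #R = 3 := by
      have h1 := hcommon p (hN p hp)
      have h2 := Finset.card_le_card hRp
      omega
    obtain ⟨x, y, z, hxy, hxz, hyz, hRxyz⟩ := Finset.card_eq_three.1 hR3
    have hx : x ∈ R := by simp [hRxyz]
    have hy : y ∈ R := by simp [hRxyz]
    have hz : z ∈ R := by simp [hRxyz]
    by_cases hxy' : H.Adj x y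
    · exact key z hz x hx y hy hxz.symm hyz.symm hxy'
    by_cases hxz' : H.Adj x z
    · exact key y hy x hx z hz hxy.symm hyz hxz'
    exfalso
    have hx3 : H.neighborFinset v ∩ H.neighborFinset x ⊆ {p, q} := by
      intro w hw
      have hw' := Finset.mem_inter.1 hw
      by_contra hwpq
      simp only [Finset.mem_insert, Finset.mem_singleton, not_or] at hwpq
      have hwR : w ∈ R := Finset.mem_erase.2 ⟨hwpq.2, Finset.mem_erase.2 ⟨hwpq.1, hw'.1⟩⟩
      have hxw := (H.mem_neighborFinset x w).1 hw'.2
      simp only [hRxyz, Finset.mem_insert, Finset.mem_singleton] at hwR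
      obtain rfl | rfl | rfl := hwR
      · exact hxw.ne rfl
      · exact hxy' hxw
      · exact hxz' hxw
    have h1 := (hcommon x (hvR x hx)).trans ((Finset.card_le_card hx3).trans Finset.card_le_two)
    omega

lemma exists_le_card_edgeFinset_eq (H : SimpleGraph W) [Fintype H.edgeSet] {m : ℕ}
    (hm : m ≤ #H.edgeFinset) : ∃ K ≤ H, ∀ [Fintype K.edgeSet], #K.edgeFinset = m := by
  obtain ⟨t, ht, rfl⟩ := Finset.exists_subset_card_eq hm
  have hte : (t : Set (Sym2 W)) ⊆ H.edgeSet := fun e he => mem_edgeFinset.1 (ht he)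
  refine ⟨fromEdgeSet t, by rw [fromEdgeSet_le]; exact Set.sdiff_subset.trans hte, ?_⟩
  intro _
  congr 1
  ext e
  rw [mem_edgeFinset, edgeSet_fromEdgeSet]
  exact ⟨fun h => h.1, fun h => ⟨h, H.not_isDiag_of_mem_edgeSet (hte h)⟩⟩

open scoped Classical in
/-- A form of Mader's theorem: a graph on `n ≥ 1` vertices with at least `3 * n - 1` edges has a
`K₅` minor. -/
theorem IsModelOn.hasMinor_of_card_edges [Fintype W] {G : SimpleGraph V} {n : ℕ} (hn : 0 < n)
    {H : SimpleGraph W} {S : Finset W} {f : W → Set V} (h : G.IsModelOn H S f)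
    (hS : #S = n) (he : 3 * n ≤ #H.edgeFinset + 1) :
    G.HasMinor (completeGraph (Fin 5)) := by
  induction n generalizing H S f with
  | zero => omega
  | succ n ih =>
    obtain ⟨K, hKH, hKe⟩ := H.exists_le_card_edgeFinset_eq
      (show 3 * (n + 1) - 1 ≤ #H.edgeFinset by omega)
    have hKe : #K.edgeFinset = 3 * (n + 1) - 1 := hKe
    replace h := h.mono hKH
    obtain ⟨e, hee⟩ : K.edgeFinset.Nonempty := Finset.card_pos.1 (by omega)
    have hn0 : 0 < n := by
      induction e with
      | h x y =>
        rw [mem_edgeFinset, mem_edgeSet] at hee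
        have : #({x, y} : Finset W) ≤ #S := Finset.card_le_card (by
          intro w hw
          simp only [Finset.mem_insert, Finset.mem_singleton] at hw
          obtain rfl | rfl := hw
          exacts [h.mem_of_adj hee, h.mem_of_adj hee.symm])
        rw [Finset.card_pair hee.ne] at this
        omega
    by_cases hc : ∀ a b, K.Adj a b → 3 ≤ #(K.neighborFinset a ∩ K.neighborFinset b)
    · obtain ⟨v, hvS, hv⟩ : ∃ v ∈ S, K.degree v ≤ 5 := by
        by_contra! hcon
        have hsum := K.sum_degrees_eq_twice_card_edges
        have h1 : ∑ v ∈ S, 6 ≤ ∑ v ∈ S, K.degree v := Finset.sum_le_sum hcon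
        have h2 : ∑ v ∈ S, K.degree v ≤ ∑ v, K.degree v :=
          Finset.sum_le_sum_of_subset (Finset.subset_univ S)
        simp only [Finset.sum_const, smul_eq_mul] at h1
        omega
      obtain hv0 | hv0 := Nat.eq_zero_or_pos (K.degree v)
      · refine ih hn0 (H := K) (S := S.erase v) (f := f)
          ⟨fun x y hxy => Finset.mem_erase.2 ⟨?_, h.mem_of_adj hxy⟩,
            fun x hx => h.connected x (Finset.mem_of_mem_erase hx),
            fun x hx y hy => h.disjoint x (Finset.mem_of_mem_erase hx) y
              (Finset.mem_of_mem_erase hy), h.exists_adj⟩ ?_ (by omega)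
        · rintro rfl
          exact hv0.not_gt ((K.degree_pos_iff_exists_adj x).2 ⟨y, hxy⟩)
        · rw [Finset.card_erase_of_mem hvS]
          omega
      · obtain hK | ⟨a, b, hab, hK⟩ := exists_contractInto_not_cliqueFree hv0 hv (hc v)
        · exact h.hasMinor_of_not_cliqueFree (by norm_num) hK
        · exact (h.contractInto hab).hasMinor_of_not_cliqueFree (by norm_num) hK
    · push Not at hc
      obtain ⟨a, b, hab, hc⟩ := hc
      have hle := card_edgeFinset_le_contractInto hab
      refine ih hn0 (h.contractInto hab) ?_ (by omega)
      rw [Finset.card_erase_of_mem (h.mem_of_adj hab.symm)]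
      omega

end Minor

end SimpleGraph

section Codes

/-- The binary code of the adjacencies of vertex `j` to the vertices `0, …, n - 1`. -/
def rowCode (a : ℕ → ℕ → Bool) (j : ℕ) : ℕ → ℕ
  | 0 => 0
  | i + 1 => 2 ^ i * (a j i).toNat + rowCode a j i

/-- The binary code of an adjacency function restricted to the vertices `0, …, k - 1`; the leading
digits are the code of the restriction to `0, …, k - 2`. -/
def adjCode (a : ℕ → ℕ → Bool) : ℕ → ℕ
  | 0 => 0
  | k + 1 => 2 ^ k * adjCode a k + rowCode a k k

/-- Whether the row `j` of `a` precedes that of `b`, with ties resolved by `rest`. -/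
def rowLe (a b : ℕ → ℕ → Bool) (j : ℕ) : ℕ → Bool → Bool
  | 0, rest => rest
  | i + 1, rest => bif a j i then bif b j i then rowLe a b j i rest else false
      else bif b j i then true else rowLe a b j i rest

/-- Whether the code of `a` precedes that of `b`, with ties resolved by `rest`. -/
def codeLe (a b : ℕ → ℕ → Bool) : ℕ → Bool → Bool
  | 0, rest => rest
  | k + 1, rest => codeLe a b k (rowLe a b k k rest)

/-- The position in the code of a graph on `k` vertices at which the row of vertex `j` starts. -/
def rowOffset : ℕ → ℕ → ℕ
  | 0, _ => 0
  | k + 1, j => bif j.beq k then 0 else k.add (rowOffset k j)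

/-- The adjacency function encoded by `m`. It reads binary digits of `m` by operations on `ℕ` that
evaluate efficiently. -/
def decodeAdj (k m i j : ℕ) : Bool :=
  Nat.ble 1 (Nat.land 1 (Nat.shiftRight m
    (bif i.blt j then (rowOffset k j).add i else (rowOffset k i).add j)))

/-- The transposition of `q.1` and `q.2`. -/
def transposePair (q : ℕ × ℕ) (x : ℕ) : ℕ :=
  bif x.beq q.1 then q.2 else bif x.beq q.2 then q.1 else x

/-- The adjacency function `a` after transposing two vertices. -/
def relabel (a : ℕ → ℕ → Bool) (q : ℕ × ℕ) : ℕ → ℕ → Bool :=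
  fun i j => a (transposePair q i) (transposePair q j)

/-- The pairs `(i, j)` with `i < j < k`. -/
def pairsBelow (k : ℕ) : List (ℕ × ℕ) :=
  (List.range k).flatMap fun j => (List.range j).map fun i => (i, j)

/-- Whether vertex `k` forms a `K₄` with three smaller vertices. -/
def completesFour (a : ℕ → ℕ → Bool) (k : ℕ) : Bool :=
  (pairsBelow k).any fun q => a k q.1 && (a k q.2 && (a q.2 q.1 &&
    (List.range q.1).any fun p => a k p && (a q.2 p && a q.1 p)))

/-- Whether the graph on `k + 1` vertices with code `m` has no `K₄` through its last vertex, and no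
transposition or product of two disjoint transpositions decreases its code. -/
def isLocallyMinimal (k m : ℕ) : Bool :=
  (!completesFour (decodeAdj (k + 1) m) k &&
    (pairsBelow (k + 1)).all fun q =>
      codeLe (decodeAdj (k + 1) m) (relabel (decodeAdj (k + 1) m) q) (k + 1) true) &&
  (pairsBelow (k + 1)).all fun q => (pairsBelow q.2).all fun r =>
    r.1.beq q.1 || (r.2.beq q.1 ||
      codeLe (decodeAdj (k + 1) m) (relabel (relabel (decodeAdj (k + 1) m) q) r) (k + 1) true)

/-- A list of codes that represents every `K₄`-free graph on `k` vertices up to isomorphism. -/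
def graphReps : ℕ → List ℕ
  | 0 => [0]
  | k + 1 => ((graphReps k).flatMap fun h =>
      (List.range (2 ^ k)).map fun s => 2 ^ k * h + s).filter (isLocallyMinimal k)

lemma rowCode_lt (a : ℕ → ℕ → Bool) (j n : ℕ) : rowCode a j n < 2 ^ n := by
  induction n with
  | zero => simp [rowCode]
  | succ n ih =>
    rw [rowCode, pow_succ]
    have : 2 ^ n * (a j n).toNat ≤ 2 ^ n * 1 := Nat.mul_le_mul_left _ (Bool.toNat_le _)
    omega

lemma rowLe_iff {a b : ℕ → ℕ → Bool} {j n : ℕ} {rest : Bool} : rowLe a b j n rest = true ↔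
    rowCode a j n < rowCode b j n ∨ rowCode a j n = rowCode b j n ∧ rest = true := by
  induction n with
  | zero => simp [rowLe, rowCode]
  | succ n ih =>
    have ha := rowCode_lt a j n
    have hb := rowCode_lt b j n
    rw [rowLe, rowCode, rowCode]
    cases a j n <;> cases b j n <;> simp [ih] <;> omega

lemma codeLe_iff {a b : ℕ → ℕ → Bool} {k : ℕ} {rest : Bool} : codeLe a b k rest = true ↔
    adjCode a k < adjCode b k ∨ adjCode a k = adjCode b k ∧ rest = true := by
  induction k generalizing rest with
  | zero => simp [codeLe, adjCode]
  | succ k ih =>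
    have ha := rowCode_lt a k k
    have hb := rowCode_lt b k k
    rw [codeLe, ih, rowLe_iff, adjCode, adjCode]
    obtain h | h | h := lt_trichotomy (adjCode a k) (adjCode b k)
    · have := Nat.mul_le_mul_left (2 ^ k) (Nat.succ_le_of_lt h)
      rw [Nat.mul_succ] at this
      simp only [h, true_or, true_iff]
      omega
    · simp [h]
    · have := Nat.mul_le_mul_left (2 ^ k) (Nat.succ_le_of_lt h)
      rw [Nat.mul_succ] at this
      simp only [h.not_gt, h.ne', false_and, or_false, false_iff]
      omega

lemma testBit_rowCode (a : ℕ → ℕ → Bool) (j : ℕ) {i n : ℕ} (h : i < n) :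
    (rowCode a j n).testBit i = a j i := by
  induction n with
  | zero => omega
  | succ n ih =>
    rw [rowCode, Nat.testBit_two_pow_mul_add _ (rowCode_lt a j n)]
    split_ifs with hi
    · exact ih hi
    · obtain rfl : i = n := by omega
      cases a j i <;> simp

lemma testBit_adjCode (a : ℕ → ℕ → Bool) {i j k : ℕ} (hij : i < j) (hjk : j < k) :
    (adjCode a k).testBit (rowOffset k j + i) = a j i := by
  induction k with
  | zero => omega
  | succ k ih =>
    rw [adjCode, Nat.testBit_two_pow_mul_add _ (rowCode_lt a k k), rowOffset]
    obtain rfl | hj := eq_or_ne j k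
    · simpa [hij] using testBit_rowCode a j hij
    · have hb : j.beq k = false := by rwa [← Bool.not_eq_true, Nat.beq_eq]
      rw [hb, cond_false, Nat.add_eq, if_neg (by omega), ← ih (by omega)]
      congr 1
      omega

lemma decodeAdj_eq_testBit (k m i j : ℕ) : decodeAdj k m i j =
    m.testBit (bif i.blt j then rowOffset k j + i else rowOffset k i + j) := by
  have hbit : ∀ n, Nat.ble 1 (Nat.land 1 (Nat.shiftRight m n)) = m.testBit n := fun n => by
    rw [Bool.eq_iff_iff, Nat.ble_eq, Nat.testBit, bne_iff_ne]
    exact Nat.one_le_iff_ne_zero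
  exact hbit _

lemma decodeAdj_adjCode {a : ℕ → ℕ → Bool} (ha : ∀ i j, a i j = a j i) {i j k : ℕ} (hij : i ≠ j)
    (hi : i < k) (hj : j < k) : decodeAdj k (adjCode a k) i j = a i j := by
  obtain h | h := hij.lt_or_gt
  · have hb : i.blt j = true := by simpa [Nat.blt_eq] using h
    rw [decodeAdj_eq_testBit, hb, cond_true, testBit_adjCode a h hj, ha]
  · have hb : i.blt j = false := by
      rw [← Bool.not_eq_true, Nat.blt_eq]
      omega
    rw [decodeAdj_eq_testBit, hb, cond_false, testBit_adjCode a h hi]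

lemma rowCode_congr {a b : ℕ → ℕ → Bool} {j n : ℕ} (h : ∀ i < n, a j i = b j i) :
    rowCode a j n = rowCode b j n := by
  induction n with
  | zero => rfl
  | succ n ih => rw [rowCode, rowCode, h n (by omega), ih fun i hi => h i (by omega)]

lemma adjCode_congr {a b : ℕ → ℕ → Bool} {k : ℕ} (h : ∀ j < k, ∀ i < j, a j i = b j i) :
    adjCode a k = adjCode b k := by
  induction k with
  | zero => rfl
  | succ k ih =>
    rw [adjCode, adjCode, ih fun j hj => h j (by omega), rowCode_congr (h k (by omega))]

lemma mem_pairsBelow {k : ℕ} {q : ℕ × ℕ} : q ∈ pairsBelow k ↔ q.1 < q.2 ∧ q.2 < k := by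
  obtain ⟨i, j⟩ := q
  simp only [pairsBelow, List.mem_flatMap, List.mem_range, List.mem_map, Prod.mk.injEq]
  constructor
  · rintro ⟨_, hj, _, hi, rfl, rfl⟩
    exact ⟨hi, hj⟩
  · rintro ⟨hi, hj⟩
    exact ⟨j, hj, i, hi, rfl, rfl⟩

lemma transposePair_eq_swap (q : ℕ × ℕ) (x : ℕ) : transposePair q x = Equiv.swap q.1 q.2 x := by
  simp only [transposePair, Equiv.swap_apply_def, Bool.cond_eq_ite, Nat.beq_eq]

/-- `a` is a symmetric `K₄`-free adjacency function whose code on `k` vertices is minimal among all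
relabelings. -/
structure IsMinimalAdj (a : ℕ → ℕ → Bool) (k : ℕ) : Prop where
  symm : ∀ i j, a i j = a j i
  not_four : ∀ s < k, ∀ r < s, ∀ q < r, ∀ p < q,
    ¬ (a s r ∧ a s q ∧ a s p ∧ a r q ∧ a r p ∧ a q p)
  code_le : ∀ σ : Equiv.Perm ℕ, (∀ i, k ≤ i → σ i = i) →
    adjCode a k ≤ adjCode (fun i j => a (σ i) (σ j)) k

lemma IsMinimalAdj.of_succ {a : ℕ → ℕ → Bool} {k : ℕ} (h : IsMinimalAdj a (k + 1)) :
    IsMinimalAdj a k where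
  symm := h.symm
  not_four s hs := h.not_four s (by omega)
  code_le σ hσ := by
    by_contra! hlt
    have hle := h.code_le σ fun i hi => hσ i (by omega)
    rw [adjCode, adjCode] at hle
    have hrow := rowCode_lt (fun i j => a (σ i) (σ j)) k k
    have := Nat.mul_le_mul_left (2 ^ k) (Nat.succ_le_of_lt hlt)
    rw [Nat.mul_succ] at this
    omega

lemma Equiv.Perm.apply_lt_of_fixes_ge {σ : Equiv.Perm ℕ} {k : ℕ} (hσ : ∀ i, k ≤ i → σ i = i)
    {i : ℕ} (hi : i < k) : σ i < k := by
  by_contra! h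
  have := σ.injective (hσ _ h)
  omega

lemma IsMinimalAdj.codeLe_decodeAdj {a : ℕ → ℕ → Bool} {k : ℕ} (h : IsMinimalAdj a k)
    (σ : Equiv.Perm ℕ) (hσ : ∀ i, k ≤ i → σ i = i) {b : ℕ → ℕ → Bool}
    (hb : ∀ i j, b i j = decodeAdj k (adjCode a k) (σ i) (σ j)) :
    codeLe (decodeAdj k (adjCode a k)) b k true = true := by
  have ha : adjCode (decodeAdj k (adjCode a k)) k = adjCode a k :=
    adjCode_congr fun j hj i hi => decodeAdj_adjCode h.symm hi.ne' hj (hi.trans hj)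
  rw [codeLe_iff, ha]
  simp only [and_true, ← le_iff_lt_or_eq]
  refine (h.code_le σ hσ).trans_eq (adjCode_congr fun j hj i hi => ?_)
  rw [hb, decodeAdj_adjCode h.symm (fun he => hi.ne' (σ.injective he))
    (Equiv.Perm.apply_lt_of_fixes_ge hσ hj)
    (Equiv.Perm.apply_lt_of_fixes_ge hσ (hi.trans hj))]

lemma IsMinimalAdj.isLocallyMinimal_adjCode {a : ℕ → ℕ → Bool} {k : ℕ}
    (h : IsMinimalAdj a (k + 1)) : isLocallyMinimal k (adjCode a (k + 1)) = true := by
  have hswap : ∀ q ∈ pairsBelow (k + 1), ∀ i, k + 1 ≤ i → Equiv.swap q.1 q.2 i = i := by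
    intro q hq i hi
    rw [mem_pairsBelow] at hq
    exact Equiv.swap_apply_of_ne_of_ne (by omega) (by omega)
  simp only [isLocallyMinimal, Bool.and_eq_true, Bool.not_eq_true', List.all_eq_true,
    Bool.or_eq_true]
  refine ⟨⟨?_, fun q hq => ?_⟩, fun q hq r hr => Or.inr (Or.inr ?_)⟩
  · rw [← Bool.not_eq_true]
    simp only [completesFour, List.any_eq_true, Bool.and_eq_true, List.mem_range]
    rintro ⟨q, hq, h1, h2, h3, p, hp, h4, h5, h6⟩
    rw [mem_pairsBelow] at hq
    rw [decodeAdj_adjCode h.symm (by omega) (by omega) (by omega)] at h1 h2 h3 h4 h5 h6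
    exact h.not_four k (by omega) q.2 hq.2 q.1 hq.1 p hp ⟨h2, h1, h4, h3, h5, h6⟩
  · exact h.codeLe_decodeAdj (Equiv.swap q.1 q.2) (hswap q hq) fun i j => by
      simp only [relabel, transposePair_eq_swap]
  · have hr' : r ∈ pairsBelow (k + 1) := by
      rw [mem_pairsBelow] at hq hr ⊢
      omega
    refine h.codeLe_decodeAdj (Equiv.swap q.1 q.2 * Equiv.swap r.1 r.2) (fun i hi => ?_)
      fun i j => by simp only [relabel, transposePair_eq_swap, Equiv.Perm.mul_apply]
    rw [Equiv.Perm.mul_apply, hswap r hr' i hi, hswap q hq i hi]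

lemma IsMinimalAdj.adjCode_mem_graphReps {a : ℕ → ℕ → Bool} {k : ℕ} (h : IsMinimalAdj a k) :
    adjCode a k ∈ graphReps k := by
  induction k with
  | zero => simp [adjCode, graphReps]
  | succ k ih =>
    refine List.mem_filter.2 ⟨?_, h.isLocallyMinimal_adjCode⟩
    exact List.mem_flatMap.2 ⟨_, ih h.of_succ,
      List.mem_map.2 ⟨_, List.mem_range.2 (rowCode_lt a k k), rfl⟩⟩

end Codes

namespace SimpleGraph

section Counting

/-- The graph on `Fin k` encoded by `m`. -/
def ofCode (k m : ℕ) : SimpleGraph (Fin k) :=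
  fromRel fun i j => decodeAdj k m i j = true

open scoped Classical in
/-- The adjacency function on `ℕ` of a graph whose vertices are labeled by `Fin k`. -/
noncomputable def labeledAdj {W : Type*} (H : SimpleGraph W) {k : ℕ} (e : Fin k ≃ W) (i j : ℕ) :
    Bool :=
  decide (∃ (hi : i < k) (hj : j < k), H.Adj (e ⟨i, hi⟩) (e ⟨j, hj⟩))

lemma labeledAdj_iff {W : Type*} {H : SimpleGraph W} {k : ℕ} {e : Fin k ≃ W} {i j : ℕ} :
    H.labeledAdj e i j = true ↔ ∃ (hi : i < k) (hj : j < k), H.Adj (e ⟨i, hi⟩) (e ⟨j, hj⟩) := by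
  simp [labeledAdj]

lemma exists_iso_ofCode {W : Type*} [Fintype W] (H : SimpleGraph W) (hH : H.CliqueFree 4) {k : ℕ}
    (hk : Fintype.card W = k) : ∃ m ∈ graphReps k, Nonempty (H ≃g ofCode k m) := by
  have : Nonempty (Fin k ≃ W) := ⟨(Fintype.equivFinOfCardEq hk).symm⟩
  obtain ⟨e, he⟩ : ∃ e : Fin k ≃ W, ∀ e' : Fin k ≃ W,
      adjCode (H.labeledAdj e) k ≤ adjCode (H.labeledAdj e') k :=
    ⟨_, fun e' => Function.argmin_le (fun e : Fin k ≃ W => adjCode (H.labeledAdj e) k) e'⟩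
  have hsymm : ∀ i j, H.labeledAdj e i j = H.labeledAdj e j i := fun i j => by
    rw [Bool.eq_iff_iff, labeledAdj_iff, labeledAdj_iff, exists_comm]
    simp only [H.adj_comm]
  have hmin : IsMinimalAdj (H.labeledAdj e) k := by
    refine ⟨hsymm, ?_, fun σ hσ => ?_⟩
    · rintro s hs r hr q hq p hp ⟨h1, h2, h3, h4, h5, h6⟩
      rw [labeledAdj_iff] at h1 h2 h3 h4 h5 h6
      obtain ⟨_, _, h1⟩ := h1
      obtain ⟨_, _, h2⟩ := h2
      obtain ⟨_, _, h3⟩ := h3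
      obtain ⟨_, _, h4⟩ := h4
      obtain ⟨_, _, h5⟩ := h5
      obtain ⟨_, _, h6⟩ := h6
      classical
      have c1 : H.IsNClique 1 {e ⟨p, by omega⟩} := by simp [isNClique_iff]
      have c2 := c1.insert (a := e ⟨q, by omega⟩) (by simpa using h6)
      have c3 := c2.insert (a := e ⟨r, by omega⟩) (by simpa using ⟨h4, h5⟩)
      exact hH _ (c3.insert (a := e ⟨s, hs⟩) (by simpa using ⟨h1, h2, h3⟩))
    · have hlt : ∀ i, i < k ↔ σ i < k := fun i =>
        ⟨Equiv.Perm.apply_lt_of_fixes_ge hσ, fun h => by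
          by_contra! hi
          rw [hσ i hi] at h
          omega⟩
      let τ : Fin k ≃ Fin k :=
        (Fin.equivSubtype.trans (σ.subtypeEquiv hlt)).trans Fin.equivSubtype.symm
      refine (he (τ.trans e)).trans_eq (adjCode_congr fun j hj i hi => ?_)
      rw [Bool.eq_iff_iff, labeledAdj_iff, labeledAdj_iff]
      constructor
      · rintro ⟨hj, hi, h⟩
        exact ⟨(hlt j).1 hj, (hlt i).1 hi, h⟩
      · rintro ⟨hj, hi, h⟩
        exact ⟨(hlt j).2 hj, (hlt i).2 hi, h⟩
  refine ⟨_, hmin.adjCode_mem_graphReps, ⟨⟨e.symm, fun {x y} => ?_⟩⟩⟩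
  obtain ⟨i, rfl⟩ := e.surjective x
  obtain ⟨j, rfl⟩ := e.surjective y
  rw [Equiv.symm_apply_apply, Equiv.symm_apply_apply, ofCode, fromRel_adj]
  obtain rfl | hij := eq_or_ne i j
  · simp
  · have hij' : (i : ℕ) ≠ j := Fin.val_ne_of_ne hij
    rw [decodeAdj_adjCode hsymm hij' i.2 j.2, decodeAdj_adjCode hsymm hij'.symm j.2 i.2,
      hsymm j i, or_self, labeledAdj_iff]
    simp [hij]

variable {V : Type*} {G : SimpleGraph V}

lemma CliqueFree.link {n : ℕ} (h : G.CliqueFree (n + 1)) (v : V) : (G.link v).CliqueFree n := by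
  classical
  intro s hs
  have hs' : G.IsNClique n (s.map (Function.Embedding.subtype _)) :=
    (hs.map (f := Function.Embedding.subtype _)).mono (map_comap_le _ _)
  refine h _ (hs'.insert (a := v) fun b hb => ?_)
  obtain ⟨⟨w, hw⟩, -, rfl⟩ := Finset.mem_map.1 hb
  exact hw

open scoped Classical in
lemma LinkIrregular.card_degree_eq_le [Fintype V] (h : G.LinkIrregular) (hG : G.CliqueFree 5)
    (k : ℕ) :
    #{v | G.degree v = k} ≤ (graphReps k).length := by
  have hrep : ∀ v, G.degree v = k → ∃ m ∈ graphReps k, Nonempty (G.link v ≃g ofCode k m) :=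
    fun v hv => exists_iso_ofCode _ (hG.link v) (by rw [card_neighborSet_eq_degree, hv])
  choose! c hc hiso using hrep
  refine (Finset.card_le_card_of_injOn c (t := (graphReps k).toFinset) (fun v hv => ?_)
    fun u hu v hv huv => ?_).trans (List.toFinset_card_le _)
  · simpa using hc v (by simpa using hv)
  · by_contra hne
    obtain ⟨φ⟩ := hiso u (by simpa using hu)
    obtain ⟨ψ⟩ := hiso v (by simpa using hv)
    rw [huv] at φ
    exact h u v hne ⟨φ.trans ψ.symm⟩

end Counting

end SimpleGraph

set_option maxRecDepth 10000 in
lemma sum_length_graphReps_le :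
    ∑ k ∈ Finset.range 7, (7 - k) * (graphReps k).length ≤ 262 := by
  decide +kernel

/-- A link-irregular graph on more than 277 vertices is not planar. -/
theorem linkIrregular_not_planar {V : Type*} [Fintype V] (G : SimpleGraph V)
    (hn : 277 < Fintype.card V) (h : G.LinkIrregular) : ¬ G.Planar := by
  classical
  rintro ⟨h5, -⟩
  have hfree : G.CliqueFree 5 := by
    by_contra hG
    exact h5 (G.isModelOn_self.hasMinor_of_not_cliqueFree (by norm_num) hG)
  have he : #G.edgeFinset + 1 < 3 * Fintype.card V := by
    by_contra! hle
    exact h5 (G.isModelOn_self.hasMinor_of_card_edges (by omega) Finset.card_univ hle)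
  have hsum := G.sum_degrees_eq_twice_card_edges
  have hdef : ∑ v, (7 - G.degree v) ≤ ∑ k ∈ Finset.range 7, (7 - k) * (graphReps k).length := by
    have hpoint : ∀ v, 7 - G.degree v =
        ∑ k ∈ Finset.range 7, if G.degree v = k then 7 - k else 0 := fun v => by
      rw [Finset.sum_ite_eq]
      split_ifs with hv
      · rfl
      · rw [Finset.mem_range] at hv
        omega
    simp_rw [hpoint]
    rw [Finset.sum_comm]
    refine Finset.sum_le_sum fun k _ => ?_
    rw [← Finset.sum_filter, Finset.sum_const, smul_eq_mul, mul_comm]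
    exact Nat.mul_le_mul_left _ (h.card_degree_eq_le hfree k)
  have hseven : 7 * Fintype.card V ≤ ∑ v, G.degree v + ∑ v, (7 - G.degree v) := by
    rw [← Finset.sum_add_distrib, mul_comm, ← smul_eq_mul, ← Finset.card_univ,
      ← Finset.sum_const]
    exact Finset.sum_le_sum fun v _ => by omega
  have hreps := sum_length_graphReps_le
  omega
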